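/- Stanley's acyclic orientation reciprocity: for a finite simple graph G = (V, E) and n ∈ ℕ, the number of pairs (Ẽ, c) with Ẽ an acyclic orientation of G and c : V → [n] compatible with Ẽ (i.e., (v,v') ∈ Ẽ ⟹ c(v) ≤ c(v')) equals (-1)^{|V|} · χ(G, -n), where χ(G, t) is the chromatic polynomial. -/

import Mathlib

/-- An acyclic orientation of a simple graph `G`: each edge receives exactly one direction,
and there is no directed cycle (no directed path from a vertex to itself). -/
structure AcyclicOrientation {V : Type} (G : SimpleGraph V) where
  dir : V → V → Prop
  sub : ∀ a b : V, dir a b → G.Adj a b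
  total : ∀ a b : V, G.Adj a b → (dir a b ↔ ¬ dir b a)
  acyclic : ∀ v : V, ¬ Relation.TransGen dir v v

open Classical in
/-- proper colourings of `G[S]` with colours `< m`, extended by zero -/
def colSet {V : Type} (G : SimpleGraph V) (S : Finset V) (m : ℕ) : Set (V → ℕ) :=
  {c | (∀ v ∈ S, c v < m) ∧ (∀ v, v ∉ S → c v = 0) ∧
    ∀ a ∈ S, ∀ b ∈ S, G.Adj a b → c a ≠ c b}

/-- compatible pairs on `G[S]` with colours `< m`, extended by zero -/
def pairSet {V : Type} (G : SimpleGraph V) (S : Finset V) (m : ℕ) :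
    Set ((V → V → Prop) × (V → ℕ)) :=
  {x | (∀ a b, x.1 a b → a ∈ S ∧ b ∈ S ∧ G.Adj a b) ∧
    (∀ a ∈ S, ∀ b ∈ S, G.Adj a b → (x.1 a b ↔ ¬ x.1 b a)) ∧
    (∀ v, ¬ Relation.TransGen x.1 v v) ∧
    (∀ v ∈ S, x.2 v < m) ∧ (∀ v, v ∉ S → x.2 v = 0) ∧
    ∀ a b, x.1 a b → x.2 a ≤ x.2 b}

/-- independent sets -/
def Indep {V : Type} (G : SimpleGraph V) (T : Finset V) : Prop :=
  ∀ a ∈ T, ∀ b ∈ T, ¬ G.Adj a b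

lemma bdd_finite {V : Type} [Fintype V] (m : ℕ) : {c : V → ℕ | ∀ v, c v < m + 1}.Finite := by
  have := Set.Finite.pi (ι := V) (t := fun _ => Set.Iio (m+1)) (fun _ => Set.finite_Iio _)
  refine this.subset ?_
  intro c hc v _
  exact hc v

lemma colSet_finite {V : Type} [Fintype V] (G : SimpleGraph V) (S : Finset V) (m : ℕ) :
    (colSet G S m).Finite := by
  refine (bdd_finite m).subset ?_
  intro c hc v
  by_cases h : v ∈ S
  · have := hc.1 v h; omega
  · have := hc.2.1 v h; omega

lemma pairSet_finite {V : Type} [Fintype V] (G : SimpleGraph V) (S : Finset V) (m : ℕ) :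
    (pairSet G S m).Finite := by
  refine ((Set.finite_univ (α := V → V → Prop)).prod (bdd_finite (V := V) m)).subset ?_
  intro x hx
  refine ⟨trivial, ?_⟩
  intro v
  by_cases h : v ∈ S
  · have := hx.2.2.2.1 v h; omega
  · have := hx.2.2.2.2.1 v h; omega

open Classical in
lemma colSet_fiber {V : Type} [Fintype V] (G : SimpleGraph V) (S T : Finset V) (m : ℕ)
    (hT : T ⊆ S) :
    (colSet G S (m+1) ∩ {c | S.filter (fun v => c v = m) = T}).ncard =
      if Indep G T then (colSet G (S \ T) m).ncard else 0 := by
  split_ifs with hI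
  · refine Set.ncard_congr (fun c _ v => if v ∈ T then 0 else c v) ?_ ?_ ?_
    · rintro c ⟨⟨h1, h2, h3⟩, h4⟩
      have h5 : ∀ v, v ∈ T ↔ v ∈ S ∧ c v = m := by
        intro v; rw [← h4]; simp
      refine ⟨?_, ?_, ?_⟩
      · intro v hv
        rw [Finset.mem_sdiff] at hv
        have := h1 v hv.1
        have := h5 v
        simp only [hv.2, if_false]
        by_contra h
        exact hv.2 ((h5 v).2 ⟨hv.1, by omega⟩)
      · intro v hv
        rw [Finset.mem_sdiff] at hv
        by_cases hvT : v ∈ T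
        · simp [hvT]
        · simp only [hvT, if_false]
          exact h2 v (fun h => hv ⟨h, hvT⟩)
      · intro a ha b hb hab
        rw [Finset.mem_sdiff] at ha hb
        simp only [ha.2, hb.2, if_false]
        exact h3 a ha.1 b hb.1 hab
    · rintro c d ⟨_, hc⟩ ⟨_, hd⟩ h
      funext v
      have := congrFun h v
      by_cases hvT : v ∈ T
      · have e1 : c v = m := by
          have : v ∈ S.filter (fun v => c v = m) := by rw [hc]; exact hvT
          exact (Finset.mem_filter.1 this).2
        have e2 : d v = m := by
          have : v ∈ S.filter (fun v => d v = m) := by rw [hd]; exact hvT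
          exact (Finset.mem_filter.1 this).2
        rw [e1, e2]
      · simpa [hvT] using this
    · rintro c ⟨h1, h2, h3⟩
      refine ⟨fun v => if v ∈ T then m else c v, ⟨⟨?_, ?_, ?_⟩, ?_⟩, ?_⟩
      · intro v hv
        by_cases hvT : v ∈ T
        · simp [hvT]
        · have := h1 v (Finset.mem_sdiff.2 ⟨hv, hvT⟩)
          simp only [hvT, if_false]; omega
      · intro v hv
        have hvT : v ∉ T := fun h => hv (hT h)
        simp only [hvT, if_false]
        exact h2 v (by simp [hv])
      · intro a ha b hb hab
        by_cases haT : a ∈ T <;> by_cases hbT : b ∈ T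
        · exact absurd hab (hI a haT b hbT)
        · have := h1 b (Finset.mem_sdiff.2 ⟨hb, hbT⟩)
          simp only [haT, hbT, if_true, if_false]; omega
        · have := h1 a (Finset.mem_sdiff.2 ⟨ha, haT⟩)
          simp only [haT, hbT, if_true, if_false]; omega
        · simp only [haT, hbT, if_false]
          exact h3 a (Finset.mem_sdiff.2 ⟨ha, haT⟩) b (Finset.mem_sdiff.2 ⟨hb, hbT⟩) hab
      · ext v
        simp only [Finset.mem_filter]
        by_cases hvT : v ∈ T
        · simp [hvT, hT hvT]
        · simp only [hvT, if_false, iff_false]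
          rintro ⟨hv, h⟩
          have := h1 v (Finset.mem_sdiff.2 ⟨hv, hvT⟩)
          omega
      · funext v
        by_cases hvT : v ∈ T
        · simp only [hvT, if_true]
          exact (h2 v (by simp [hvT])).symm
        · simp [hvT]
  · rw [Set.ncard_eq_zero ((colSet_finite G S (m+1)).inter_of_left _)]
    rw [Set.eq_empty_iff_forall_notMem]
    rintro c ⟨⟨h1, h2, h3⟩, h4⟩
    apply hI
    intro a ha b hb hab
    rw [← h4] at ha hb
    simp only [Finset.mem_filter] at ha hb
    exact h3 a ha.1 b hb.1 hab (ha.2.trans hb.2.symm)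

open Classical in
lemma colSet_succ {V : Type} [Fintype V] (G : SimpleGraph V) (S : Finset V) (m : ℕ) :
    (colSet G S (m+1)).ncard =
      ∑ T ∈ S.powerset with Indep G T, (colSet G (S \ T) m).ncard := by
  rw [Finset.sum_filter]
  rw [Set.ncard_eq_toFinset_card _ (colSet_finite G S (m+1))]
  rw [Finset.card_eq_sum_card_fiberwise (t := S.powerset)
    (f := fun c : V → ℕ => S.filter (fun v => c v = m))]
  · refine Finset.sum_congr rfl ?_
    intro T hT
    rw [← colSet_fiber G S T m (Finset.mem_powerset.1 hT), ← Set.ncard_coe_finset]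
    congr 1
    ext c
    simp
  · intro c _
    simp only [Finset.coe_powerset, Set.mem_preimage, Set.mem_powerset_iff, Finset.coe_subset]
    exact Finset.filter_subset _ _

lemma antidiff (q : Polynomial ℚ) : ∃ r : Polynomial ℚ,
    ∀ x : ℚ, r.eval (x + 1) - r.eval x = q.eval x := by
  induction q using Polynomial.induction_on' with
  | add p q hp hq =>
    obtain ⟨r, hr⟩ := hp
    obtain ⟨s, hs⟩ := hq
    refine ⟨r + s, fun x => ?_⟩
    have := hr x
    have := hs x
    simp only [Polynomial.eval_add]
    linarith
  | monomial n a =>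
    refine ⟨Polynomial.C (a / (n+1)) * Polynomial.bernoulli (n+1), fun x => ?_⟩
    have := Polynomial.bernoulli_eval_one_add (n+1) x
    rw [add_comm x 1]
    simp only [Polynomial.eval_mul, Polynomial.eval_C, this, Polynomial.eval_monomial]
    push_cast
    have : (n:ℚ) + 1 ≠ 0 := by positivity
    try simp only [Nat.add_sub_cancel]
    field_simp
    ring

lemma indep_empty {V : Type} (G : SimpleGraph V) : Indep G ∅ := by
  intro a ha; simp at ha

open Classical in
lemma split_empty {V : Type} (G : SimpleGraph V) (S : Finset V)
    (f : Finset V → ℚ) :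
    ∑ T ∈ S.powerset with Indep G T, f T =
      f ∅ + ∑ T ∈ (S.powerset.filter (Indep G)).erase ∅, f T := by
  rw [Finset.add_sum_erase]
  simp [indep_empty]

lemma sdiff_lt_aux {V : Type} [DecidableEq V] {S T : Finset V} (hT : T ⊆ S) (h : T ≠ ∅) :
    S \ T ⊂ S :=
  Finset.sdiff_ssubset hT (Finset.nonempty_iff_ne_empty.2 h)

open Classical in
lemma exists_poly {V : Type} [Fintype V] (G : SimpleGraph V) (S : Finset V) :
    ∃ Q : Polynomial ℚ, ∀ m : ℕ, Q.eval (m : ℚ) = (colSet G S m).ncard := by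
  induction S using Finset.strongInduction with
  | H S ih =>
  have ih' : ∀ T : Finset V, ∃ Q : Polynomial ℚ, T ⊆ S → T ≠ ∅ →
      ∀ m : ℕ, Q.eval (m : ℚ) = (colSet G (S \ T) m).ncard := by
    intro T
    by_cases h : T ⊆ S ∧ T ≠ ∅
    · obtain ⟨Q, hQ⟩ := ih _ (sdiff_lt_aux h.1 h.2)
      exact ⟨Q, fun _ _ => hQ⟩
    · exact ⟨0, fun h1 h2 => absurd ⟨h1, h2⟩ h⟩
  choose Q hQ using ih'
  obtain ⟨r, hr⟩ := antidiff (∑ T ∈ (S.powerset.filter (Indep G)).erase ∅, Q T)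
  refine ⟨r + Polynomial.C ((colSet G S 0).ncard - r.eval 0), fun m => ?_⟩
  induction m with
  | zero => simp
  | succ m ihm =>
    have h1 := hr m
    rw [colSet_succ]
    push_cast
    rw [split_empty G S (fun T => ((colSet G (S \ T) m).ncard : ℚ))]
    rw [Finset.sdiff_empty, ← ihm]
    rw [Polynomial.eval_finsetSum] at h1
    have h2 : ∑ T ∈ (S.powerset.filter (Indep G)).erase ∅, (Q T).eval (m:ℚ) =
      ∑ T ∈ (S.powerset.filter (Indep G)).erase ∅, ((colSet G (S \ T) m).ncard : ℚ) := by
      refine Finset.sum_congr rfl fun T hT => ?_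
      simp only [Finset.mem_erase, Finset.mem_filter, Finset.mem_powerset] at hT
      exact hQ T hT.2.1 hT.1 m
    rw [← h2, ← h1]
    simp only [Polynomial.eval_add, Polynomial.eval_C]
    ring

open Classical in
lemma pairSet_fiber {V : Type} [Fintype V] (G : SimpleGraph V) (S T : Finset V) (n : ℕ)
    (hT : T ⊆ S) :
    (pairSet G S (n+1) ∩ {x | T ⊆ S.filter (fun v => x.2 v = n ∧ ∀ b, ¬ x.1 v b)}).ncard =
      if Indep G T then (pairSet G (S \ T) (n+1)).ncard else 0 := by
  split_ifs with hI
  · symm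
    refine Set.ncard_congr (fun x _ => (fun a b => x.1 a b ∨ (a ∈ S ∧ b ∈ T ∧ G.Adj a b),
      fun v => if v ∈ T then n else x.2 v)) ?_ ?_ ?_
    · rintro ⟨d, c⟩ ⟨h1, h2, h3, h4, h5, h6⟩
      simp only [Finset.mem_sdiff] at h1 h2 h3 h4 h5 h6
      have hsink : ∀ t ∈ T, ∀ b, ¬ (d t b ∨ (t ∈ S ∧ b ∈ T ∧ G.Adj t b)) := by
        rintro t ht b (h | h)
        · exact (h1 _ _ h).1.2 ht
        · exact hI t ht b h.2.1 h.2.2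
      have key : ∀ a b, Relation.TransGen (fun a b => d a b ∨ (a ∈ S ∧ b ∈ T ∧ G.Adj a b)) a b →
          b ∉ T → Relation.TransGen d a b := by
        intro a b h
        induction h with
        | single h =>
          intro hb
          rcases h with h | h
          · exact .single h
          · exact absurd h.2.1 hb
        | tail h1 h ih =>
          intro hb
          rename_i b' c'
          have hb' : b' ∉ T := fun hh => hsink _ hh _ h
          rcases h with h | h
          · exact .tail (ih hb') h
          · exact absurd h.2.1 hb
      refine ⟨⟨?_, ?_, ?_, ?_, ?_, ?_⟩, ?_⟩
      · rintro a b (h | h)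
        · have := h1 a b h; exact ⟨this.1.1, this.2.1.1, this.2.2⟩
        · exact ⟨h.1, hT h.2.1, h.2.2⟩
      · intro a ha b hb hab
        have hba := hab.symm
        by_cases haT : a ∈ T <;> by_cases hbT : b ∈ T
        · exact absurd hab (hI a haT b hbT)
        · have := hsink a haT b
          simp only [this, false_iff, not_not]
          exact Or.inr ⟨hb, haT, hba⟩
        · have := hsink b hbT a
          simp only [this, not_false_eq_true, iff_true]
          exact Or.inr ⟨ha, hbT, hab⟩
        · have := h2 a ⟨ha, haT⟩ b ⟨hb, hbT⟩ hab
          simpa [haT, hbT] using this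
      · intro v hv
        by_cases hvT : v ∈ T
        · obtain ⟨b, hb, _⟩ := Relation.TransGen.head'_iff.1 hv
          exact hsink v hvT b hb
        · exact h3 v (key v v hv hvT)
      · intro v hv
        by_cases hvT : v ∈ T
        · simp [hvT]
        · simpa [hvT] using h4 v ⟨hv, hvT⟩
      · intro v hv
        have hvT : v ∉ T := fun h => hv (hT h)
        simpa [hvT] using h5 v (fun h => hv h.1)
      · intro a b h
        have haT : a ∉ T := fun hh => hsink a hh b h
        by_cases hbT : b ∈ T
        · have ha : a ∈ S := by
            rcases h with h | h
            · exact (h1 _ _ h).1.1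
            · exact h.1
          have := h4 a ⟨ha, haT⟩
          simp only [haT, hbT, if_true, if_false]; omega
        · simp only [haT, hbT, if_false]
          rcases h with h | h
          · exact h6 _ _ h
          · exact absurd h.2.1 hbT
      · intro t ht
        simp only [Finset.mem_filter]
        exact ⟨hT ht, by simp [ht], hsink t ht⟩
    · rintro ⟨d, c⟩ ⟨d', c'⟩ ⟨h1, h2, h3, h4, h5, h6⟩ ⟨h1', h2', h3', h4', h5', h6'⟩ h
      simp only [Finset.mem_sdiff] at h1 h2 h3 h4 h5 h6 h1' h2' h3' h4' h5' h6'
      simp only [Prod.mk.injEq] at h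
      refine Prod.ext ?_ ?_
      · funext a b
        have := congrFun (congrFun h.1 a) b
        by_cases hbT : b ∈ T
        · have e1 : ¬ d a b := fun hh => (h1 _ _ hh).2.1.2 hbT
          have e2 : ¬ d' a b := fun hh => (h1' _ _ hh).2.1.2 hbT
          simp [e1, e2]
        · simpa [hbT] using this
      · funext v
        have := congrFun h.2 v
        by_cases hvT : v ∈ T
        · have e1 := h5 v (fun hh => hh.2 hvT)
          have e2 := h5' v (fun hh => hh.2 hvT)
          exact e1.trans e2.symm
        · simpa [hvT] using this
    · rintro ⟨d, c⟩ ⟨⟨h1, h2, h3, h4, h5, h6⟩, h7⟩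
      simp only at h1 h2 h3 h4 h5 h6
      have h8 : ∀ t ∈ T, c t = n ∧ ∀ b, ¬ d t b := fun t ht => (Finset.mem_filter.1 (h7 ht)).2
      refine ⟨(fun a b => d a b ∧ b ∉ T, fun v => if v ∈ T then 0 else c v),
        ⟨?_, ?_, ?_, ?_, ?_, ?_⟩, ?_⟩
      · rintro a b ⟨h, hb⟩
        have := h1 a b h
        simp only [Finset.mem_sdiff]
        exact ⟨⟨this.1, fun ha => (h8 a ha).2 b h⟩, ⟨this.2.1, hb⟩, this.2.2⟩
      · intro a ha b hb hab
        rw [Finset.mem_sdiff] at ha hb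
        simpa [ha.2, hb.2] using h2 a ha.1 b hb.1 hab
      · intro v hv
        exact h3 v (Relation.TransGen.mono (r := fun a b => d a b ∧ b ∉ T) (p := d) (fun _ _ h => h.1) v v hv)
      · intro v hv
        rw [Finset.mem_sdiff] at hv
        simpa [hv.2] using h4 v hv.1
      · intro v hv
        rw [Finset.mem_sdiff] at hv
        by_cases hvT : v ∈ T
        · simp [hvT]
        · simpa [hvT] using h5 v (fun h => hv ⟨h, hvT⟩)
      · rintro a b ⟨h, hb⟩
        have haT : a ∉ T := fun ha => (h8 a ha).2 b h
        simpa [haT, hb] using h6 a b h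
      · refine Prod.ext ?_ ?_
        · funext a b
          simp only [eq_iff_iff]
          constructor
          · rintro (h | h)
            · exact h.1
            · exact (h2 a h.1 b (hT h.2.1) h.2.2).2 ((h8 b h.2.1).2 a)
          · intro h
            by_cases hbT : b ∈ T
            · exact Or.inr ⟨(h1 a b h).1, hbT, (h1 a b h).2.2⟩
            · exact Or.inl ⟨h, hbT⟩
        · funext v
          by_cases hvT : v ∈ T
          · simp [hvT, (h8 v hvT).1]
          · simp [hvT]
  · rw [Set.ncard_eq_zero ((pairSet_finite G S (n+1)).inter_of_left _)]
    rw [Set.eq_empty_iff_forall_notMem]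
    rintro ⟨d, c⟩ ⟨⟨h1, h2, h3, h4, h5, h6⟩, h7⟩
    apply hI
    intro a ha b hb hab
    have h8 : ∀ t ∈ T, c t = n ∧ ∀ b, ¬ d t b := fun t ht => (Finset.mem_filter.1 (h7 ht)).2
    exact (h8 a ha).2 b ((h2 a (hT ha) b (hT hb) hab).2 ((h8 b hb).2 a))

open Classical in
lemma pairSet_sinkless {V : Type} [Fintype V] (G : SimpleGraph V) (S : Finset V) (n : ℕ) :
    pairSet G S (n+1) ∩ {x | S.filter (fun v => x.2 v = n ∧ ∀ b, ¬ x.1 v b) = ∅} =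
      pairSet G S n := by
  ext ⟨d, c⟩
  constructor
  · rintro ⟨⟨h1, h2, h3, h4, h5, h6⟩, h7⟩
    simp only at h1 h2 h3 h4 h5 h6
    refine ⟨h1, h2, h3, ?_, h5, h6⟩
    by_contra! hcon
    obtain ⟨v, hv, hvn⟩ := hcon
    simp only at hvn
    let R : V → V → Prop := fun a b => Relation.TransGen d b a
    have : IsTrans V R := ⟨fun a b c hab hbc => Relation.TransGen.trans hbc hab⟩
    have : Std.Irrefl R := ⟨fun a h => h3 a h⟩
    have wf : WellFounded R := Finite.wellFounded_of_trans_of_irrefl R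
    have hne : {v | v ∈ S ∧ c v = n}.Nonempty := ⟨v, hv, by have := h4 v hv; omega⟩
    obtain ⟨w, ⟨hw, hwn⟩, hmin⟩ := wf.has_min _ hne
    have : w ∈ S.filter (fun v => c v = n ∧ ∀ b, ¬ d v b) := by
      refine Finset.mem_filter.2 ⟨hw, hwn, fun b hb => ?_⟩
      have hbS := (h1 w b hb).2.1
      have := h4 b hbS
      have := h6 w b hb
      exact hmin b ⟨hbS, by omega⟩ (.single hb)
    simp only [Set.mem_ofPred_eq] at h7
    rw [h7] at this
    simp at this
  · rintro ⟨h1, h2, h3, h4, h5, h6⟩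
    refine ⟨⟨h1, h2, h3, fun v hv => Nat.lt_succ_of_lt (h4 v hv), h5, h6⟩, ?_⟩
    simp only [Set.mem_ofPred_eq]
    rw [Finset.filter_eq_empty_iff]
    rintro v hv ⟨h, _⟩
    have := h4 v hv
    simp only at this
    omega

open Classical in
lemma pairSet_rec {V : Type} [Fintype V] (G : SimpleGraph V) (S : Finset V) (n : ℕ) :
    ((pairSet G S n).ncard : ℤ) =
      ∑ T ∈ S.powerset with Indep G T, (-1) ^ T.card * ((pairSet G (S \ T) (n+1)).ncard : ℤ) := by
  set A : ((V → V → Prop) × (V → ℕ)) → Finset V :=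
    fun x => S.filter (fun v => x.2 v = n ∧ ∀ b, ¬ x.1 v b) with hA
  set F := (pairSet_finite G S (n+1)).toFinset with hF
  have e1 : ∑ T ∈ S.powerset with Indep G T,
      (-1) ^ T.card * ((pairSet G (S \ T) (n+1)).ncard : ℤ) =
      ∑ T ∈ S.powerset, ∑ x ∈ F, if T ⊆ A x then (-1 : ℤ) ^ T.card else 0 := by
    rw [Finset.sum_filter]
    refine Finset.sum_congr rfl fun T hT => ?_
    have h := pairSet_fiber G S T n (Finset.mem_powerset.1 hT)
    have h' : (F.filter (fun x => T ⊆ A x)).card =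
        if Indep G T then (pairSet G (S \ T) (n+1)).ncard else 0 := by
      rw [← h, ← Set.ncard_coe_finset]
      congr 1
      ext x
      simp [hF, hA]
    rw [← Finset.sum_filter, Finset.sum_const, h']
    split_ifs <;> simp [mul_comm]
  rw [e1, Finset.sum_comm]
  have e2 : ∀ x ∈ F, (∑ T ∈ S.powerset, if T ⊆ A x then (-1 : ℤ) ^ T.card else 0) =
      if A x = ∅ then 1 else 0 := by
    intro x _
    rw [← Finset.sum_powerset_neg_one_pow_card, ← Finset.sum_filter]
    refine Finset.sum_congr ?_ fun _ _ => rfl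
    ext T
    simp only [Finset.mem_filter, Finset.mem_powerset]
    exact ⟨fun h => h.2, fun h => ⟨h.trans (Finset.filter_subset _ _), h⟩⟩
  rw [Finset.sum_congr rfl e2, ← Finset.sum_filter, Finset.sum_const, nsmul_eq_mul, mul_one]
  rw [← pairSet_sinkless, ← Set.ncard_coe_finset]
  congr 2
  ext x
  simp [hF, hA]

lemma colSet_zero {V : Type} [Fintype V] (G : SimpleGraph V) (S : Finset V) :
    (colSet G S 0).ncard = (pairSet G S 0).ncard := by
  rcases S.eq_empty_or_nonempty with rfl | ⟨v, hv⟩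
  · have h1 : colSet G ∅ 0 = {fun _ => 0} := by
      ext c
      simp [colSet, funext_iff]
    have h2 : pairSet G ∅ 0 = {(fun _ _ => False, fun _ => 0)} := by
      ext ⟨d, c⟩
      simp only [pairSet, Set.mem_ofPred_eq, Set.mem_singleton_iff, Prod.mk.injEq]
      constructor
      · rintro ⟨h1, _, _, _, h5, _⟩
        refine ⟨?_, ?_⟩
        · funext a b
          simp only [eq_iff_iff, iff_false]
          intro h
          have := (h1 a b h).1
          simp at this
        · funext v
          exact h5 v (by simp)
      · rintro ⟨rfl, rfl⟩
        refine ⟨by simp, by simp, ?_, by simp, by simp, by simp⟩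
        intro v hv
        obtain ⟨b, hb, _⟩ := Relation.TransGen.head'_iff.1 hv
        exact hb
    rw [h1, h2, Set.ncard_singleton, Set.ncard_singleton]
  · have h1 : colSet G S 0 = ∅ := by
      rw [Set.eq_empty_iff_forall_notMem]
      intro c hc
      exact absurd (hc.1 v hv) (by simp)
    have h2 : pairSet G S 0 = ∅ := by
      rw [Set.eq_empty_iff_forall_notMem]
      intro c hc
      exact absurd (hc.2.2.2.1 v hv) (by simp)
    rw [h1, h2]
    simp

lemma pairSet_zero {V : Type} [Fintype V] (G : SimpleGraph V) (S : Finset V) :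
    (-1 : ℚ) ^ S.card * ((pairSet G S 0).ncard : ℚ) = (pairSet G S 0).ncard := by
  rcases S.eq_empty_or_nonempty with rfl | ⟨v, hv⟩
  · simp
  · have h2 : pairSet G S 0 = ∅ := by
      rw [Set.eq_empty_iff_forall_notMem]
      intro c hc
      exact absurd (hc.2.2.2.1 v hv) (by simp)
    rw [h2]
    simp

open Classical in
lemma recip {V : Type} [Fintype V] (G : SimpleGraph V) (Q : Finset V → Polynomial ℚ)
    (hQ : ∀ S, ∀ m : ℕ, (Q S).eval (m : ℚ) = (colSet G S m).ncard) (n : ℕ) :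
    ∀ S, (-1 : ℚ) ^ S.card * (Q S).eval (-(n : ℚ)) = (pairSet G S n).ncard := by
  have hrec : ∀ S, ∀ x : ℚ, (Q S).eval (x + 1) =
      ∑ T ∈ S.powerset with Indep G T, (Q (S \ T)).eval x := by
    intro S
    have : (Q S).comp (Polynomial.X + 1) = ∑ T ∈ S.powerset with Indep G T, Q (S \ T) := by
      refine Polynomial.eq_of_infinite_eval_eq _ _ ?_
      refine (Set.infinite_range_of_injective (Nat.cast_injective (R := ℚ))).mono ?_
      rintro _ ⟨m, rfl⟩
      simp only [Set.mem_ofPred_eq, Polynomial.eval_comp, Polynomial.eval_finsetSum,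
        Polynomial.eval_add, Polynomial.eval_X, Polynomial.eval_one]
      have := hQ S (m+1)
      push_cast at this
      rw [this, colSet_succ]
      push_cast
      exact Finset.sum_congr rfl fun T _ => (hQ _ m).symm
    intro x
    have h := congrArg (Polynomial.eval x) this
    simpa [Polynomial.eval_comp, Polynomial.eval_finsetSum] using h
  induction n with
  | zero =>
    intro S
    have := hQ S 0
    rw [colSet_zero] at this
    simp only [Nat.cast_zero, neg_zero] at this ⊢
    rw [this, pairSet_zero]
  | succ n ih =>
    intro S
    induction S using Finset.strongInduction with
    | H S ihS =>
    have h1 := ih S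
    have h2 : ((pairSet G S n).ncard : ℚ) = ∑ T ∈ S.powerset with Indep G T,
        (-1) ^ T.card * ((pairSet G (S \ T) (n+1)).ncard : ℚ) := by
      exact_mod_cast pairSet_rec G S n
    have h3 := hrec S (-((n+1 : ℕ) : ℚ))
    have h4 : -((n+1 : ℕ) : ℚ) + 1 = -(n:ℚ) := by push_cast; ring
    rw [h4] at h3
    rw [h3, h2, split_empty, split_empty] at h1
    rw [mul_add, Finset.mul_sum] at h1
    have h5 : ∑ T ∈ (S.powerset.filter (Indep G)).erase ∅,
        (-1 : ℚ) ^ S.card * (Q (S \ T)).eval (-((n+1 : ℕ) : ℚ)) =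
        ∑ T ∈ (S.powerset.filter (Indep G)).erase ∅,
        (-1) ^ T.card * ((pairSet G (S \ T) (n+1)).ncard : ℚ) := by
      refine Finset.sum_congr rfl fun T hT => ?_
      simp only [Finset.mem_erase, Finset.mem_filter, Finset.mem_powerset] at hT
      rw [← ihS _ (sdiff_lt_aux hT.2.1 hT.1), ← mul_assoc, ← pow_add, add_comm T.card,
        Finset.card_sdiff_add_card_eq_card hT.2.1]
    rw [h5] at h1
    simpa using h1

/-- Stanley's acyclic orientation reciprocity: for a finite simple graph `G = (V, E)` and
`n ∈ ℕ`, the number of pairs `(Ẽ, c)` with `Ẽ` an acyclic orientation of `G` and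
`c : V → [n]` compatible with `Ẽ` (i.e. `(v,v') ∈ Ẽ ⟹ c v ≤ c v'`) equals
`(-1)^{|V|} · χ(G, -n)`, where `χ(G,·)` is the chromatic polynomial. -/
theorem stmt_15 (V : Type) [Fintype V] (G : SimpleGraph V) (n : ℕ)
    (p : Polynomial ℤ)
    (hp : ∀ m : ℕ, p.eval (m : ℤ) =
      Nat.card {c : V → Fin m // ∀ a b : V, G.Adj a b → c a ≠ c b}) :
    (Nat.card {oc : AcyclicOrientation G × (V → Fin n) //
        ∀ a b : V, oc.1.dir a b → oc.2 a ≤ oc.2 b} : ℤ) =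
      (-1 : ℤ) ^ (Fintype.card V) * p.eval (-(n : ℤ)) := by
  choose Q hQ using exists_poly G
  have hr := recip G Q hQ n Finset.univ
  have hcol : ∀ m : ℕ, Nat.card {c : V → Fin m // ∀ a b : V, G.Adj a b → c a ≠ c b} =
      (colSet G Finset.univ m).ncard := by
    intro m
    rw [← Nat.card_coe_set_eq]
    refine Nat.card_congr
      { toFun := fun c => ⟨fun v => (c.1 v : ℕ), ?_, ?_, ?_⟩
        invFun := fun c => ⟨fun v => ⟨c.1 v, c.2.1 v (Finset.mem_univ _)⟩, ?_⟩
        left_inv := ?_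
        right_inv := ?_ }
    · intro v _; exact (c.1 v).2
    · intro v hv; simp at hv
    · intro a _ b _ hab h
      exact c.2 a b hab (Fin.ext h)
    · intro a b hab h
      exact c.2.2.2 a (Finset.mem_univ _) b (Finset.mem_univ _) hab (by simpa using h)
    · intro c; rfl
    · intro c; rfl
  have hpair : Nat.card {oc : AcyclicOrientation G × (V → Fin n) //
        ∀ a b : V, oc.1.dir a b → oc.2 a ≤ oc.2 b} = (pairSet G Finset.univ n).ncard := by
    rw [← Nat.card_coe_set_eq]
    refine Nat.card_congr
      { toFun := fun x => ⟨(x.1.1.dir, fun v => (x.1.2 v : ℕ)), ?_, ?_, ?_, ?_, ?_, ?_⟩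
        invFun := fun x => ⟨(⟨x.1.1, fun a b h => (x.2.1 a b h).2.2,
          fun a b h => x.2.2.1 a (Finset.mem_univ _) b (Finset.mem_univ _) h,
          x.2.2.2.1⟩, fun v => ⟨x.1.2 v, x.2.2.2.2.1 v (Finset.mem_univ _)⟩), ?_⟩
        left_inv := ?_
        right_inv := ?_ }
    · intro a b h
      exact ⟨Finset.mem_univ _, Finset.mem_univ _, x.1.1.sub a b h⟩
    · intro a _ b _ h; exact x.1.1.total a b h
    · exact x.1.1.acyclic
    · intro v _; exact (x.1.2 v).2
    · intro v hv; simp at hv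
    · intro a b h; exact x.2 a b h
    · intro a b h; exact x.2.2.2.2.2.2 a b h
    · intro x; rfl
    · intro x; rfl
  have hpQ : p.map (Int.castRingHom ℚ) = Q Finset.univ := by
    refine Polynomial.eq_of_infinite_eval_eq _ _ ?_
    refine (Set.infinite_range_of_injective (Nat.cast_injective (R := ℚ))).mono ?_
    rintro _ ⟨m, rfl⟩
    simp only [Set.mem_ofPred_eq]
    rw [hQ, ← hcol]
    have := congrArg (Int.cast : ℤ → ℚ) (hp m)
    have h2 := Polynomial.eval_intCast_map (Int.castRingHom ℚ) p (m : ℤ)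
    simp only [Int.cast_natCast] at h2 this
    rw [h2, ← this]
    simp
  rw [hpair]
  rw [← hpQ, Finset.card_univ] at hr
  have h2 := Polynomial.eval_intCast_map (Int.castRingHom ℚ) p (-(n : ℤ))
  push_cast at h2
  rw [h2] at hr
  have : (((-1 : ℤ) ^ (Fintype.card V) * p.eval (-(n : ℤ)) : ℤ) : ℚ) =
      (((pairSet G Finset.univ n).ncard : ℤ) : ℚ) := by
    push_cast
    simpa using hr
  exact_mod_cast this.symm
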